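/- Let T be a rooted tree and define λ : V(T) → {x,y} by λ(v) = y if v is an internal vertex and λ(v) = x if v is a leaf. Then (T,λ) is a special pair and P(T,λ) = B(T), where B is defined recursively by B(•) = x for the single-vertex tree and B(T) = y + ∏_{i=1}^k B(T_i) for T = ∧(T_1,...,T_k). Consequently, for rooted trees T and T', B(T) = B(T') if and only if T is isomorphic to T'. -/

import Mathlib

/-- A rooted tree whose vertices carry labels from `K`. -/
inductive RTree (K : Type) : Type where
  | node : K → List (RTree K) → RTree K

namespace RTree

mutual
/-- The polynomial `P(T,λ)` of a vertex-labelled rooted tree. -/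
noncomputable def P {K : Type} : RTree K → MvPolynomial K ℤ
  | .node k [] => MvPolynomial.X k
  | .node k (t :: ts) => MvPolynomial.X k + Pprod (t :: ts)
termination_by t => sizeOf t
/-- Product of the polynomials of a list of labelled trees. -/
noncomputable def Pprod {K : Type} : List (RTree K) → MvPolynomial K ℤ
  | [] => 1
  | t :: ts => P t * Pprod ts
termination_by l => sizeOf l
end

/-- Isomorphism of vertex-labelled rooted trees: roots have the same label and
the children correspond bijectively by isomorphisms. -/
inductive Iso {K : Type} : RTree K → RTree K → Prop
  | node (k : K) (ts ts' : List (RTree K)) (e : Fin ts.length ≃ Fin ts'.length)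
      (h : ∀ i : Fin ts.length, Iso (ts.get i) (ts'.get (e i))) :
      Iso (.node k ts) (.node k ts')

end RTree

/-- The variables: leaf variables `x i`, the variables `y`, `z`, and a set `S`
of further variables (all pairwise distinct). -/
inductive Var (S : Type) : Type where
  | x : ℕ → Var S
  | y : Var S
  | z : Var S
  | s : S → Var S

mutual
/-- `SpecialAux b T` says the vertex-labelled tree `T` is special; the flag `b`
records whether the (virtual) parent of the root has outdegree 1. -/
def SpecialAux {S : Type} : Bool → RTree (Var S) → Prop
  | _, .node k [] => ∃ i, k = Var.x i
  | b, .node k [t] => (k = Var.y ∨ (b = false ∧ k = Var.z)) ∧ SpecialAux true t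
  | _, .node k (t₁ :: t₂ :: ts) =>
      (k = Var.y ∨ k = Var.z ∨ ∃ a, k = Var.s a) ∧ SpecialList (t₁ :: t₂ :: ts)
/-- All trees in the list are special (as non-string-continuation subtrees). -/
def SpecialList {S : Type} : List (RTree (Var S)) → Prop
  | [] => True
  | t :: ts => SpecialAux false t ∧ SpecialList ts
end

/-- A special pair: leaves are labelled by variables `x i`, a string
`(w₁,…,w_p)` is labelled so that `λ(w₁) ∈ {y,z}` and `λ(w_i) = y` for `i ≥ 2`,
and all remaining vertices have labels in `{y,z} ∪ S`. -/
def IsSpecial {S : Type} (T : RTree (Var S)) : Prop := SpecialAux false T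


mutual
/-- Liu's polynomial `B` of a rooted tree (vertex labels are ignored), with the
variable `x` taken to be `x 1` and the variable `y` taken to be `y`:
`B(•) = x` and `B(∧(T₁,…,T_k)) = y + ∏ᵢ B(Tᵢ)`. -/
noncomputable def B {S K : Type} : RTree K → MvPolynomial (Var S) ℤ
  | .node _ [] => MvPolynomial.X (Var.x 1)
  | .node _ (t :: ts) => MvPolynomial.X Var.y + Bprod (t :: ts)
termination_by t => sizeOf t
noncomputable def Bprod {S K : Type} : List (RTree K) → MvPolynomial (Var S) ℤ
  | [] => 1
  | t :: ts => B t * Bprod ts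
termination_by l => sizeOf l
end

mutual
/-- Liu's labelling of a rooted tree: every leaf gets label `x (= x 1)` and every
internal vertex gets label `y`. -/
def liuLabel {S K : Type} : RTree K → RTree (Var S)
  | .node _ [] => .node (Var.x 1) []
  | .node _ (t :: ts) => .node Var.y (liuLabelList (t :: ts))
termination_by t => sizeOf t
def liuLabelList {S K : Type} : List (RTree K) → List (RTree (Var S))
  | [] => []
  | t :: ts => liuLabel t :: liuLabelList ts
termination_by l => sizeOf l
end

section Helpers

theorem RTree.ind {K : Type} {motive : RTree K → Prop}
    (h : ∀ k ts, (∀ t ∈ ts, motive t) → motive (.node k ts)) : ∀ t, motive t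
  | .node k ts => h k ts (fun t ht => RTree.ind h t)
termination_by t => sizeOf t
decreasing_by
  have := List.sizeOf_lt_of_mem ht
  simp
  omega

theorem Bprod_eq {S K : Type} (ts : List (RTree K)) :
    Bprod (S := S) ts = (ts.map B).prod := by
  induction ts with
  | nil => simp [Bprod]
  | cons t ts ih => simp [Bprod, ih]

theorem Pprod_eq {K : Type} (ts : List (RTree K)) :
    RTree.Pprod ts = (ts.map RTree.P).prod := by
  induction ts with
  | nil => simp [RTree.Pprod]
  | cons t ts ih => simp [RTree.Pprod, ih]

theorem liuLabelList_eq {S K : Type} (ts : List (RTree K)) :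
    liuLabelList (S := S) ts = ts.map liuLabel := by
  induction ts with
  | nil => simp [liuLabelList]
  | cons t ts ih => simp [liuLabelList, ih]

theorem specialList_iff {S : Type} (ts : List (RTree (Var S))) :
    SpecialList ts ↔ ∀ t ∈ ts, SpecialAux false t := by
  induction ts with
  | nil => simp [SpecialList]
  | cons t ts ih => simp [SpecialList, ih]

theorem liu_special {S K : Type} (T : RTree K) :
    ∀ b, SpecialAux (S := S) b (liuLabel T) := by
  induction T using RTree.ind with
  | h k ts ih =>
    intro b
    match ts, ih with
    | [], _ => simp [liuLabel, SpecialAux]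
    | [t], ih =>
      simp only [liuLabel, liuLabelList, SpecialAux]
      exact ⟨Or.inl (by trivial), ih t (by simp) true⟩
    | t₁ :: t₂ :: ts, ih =>
      simp only [liuLabel, liuLabelList, SpecialAux]
      refine ⟨Or.inl (by trivial), ?_⟩
      have h : liuLabel (S := S) t₁ :: liuLabel t₂ :: liuLabelList ts
        = (t₁ :: t₂ :: ts).map liuLabel := by simp [liuLabelList_eq]
      rw [h, specialList_iff]
      intro t ht
      obtain ⟨a, ha, rfl⟩ := List.mem_map.1 ht
      exact ih a ha false

theorem liu_P {S K : Type} (T : RTree K) : (liuLabel (S := S) T).P = B T := by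
  induction T using RTree.ind with
  | h k ts ih =>
    match ts, ih with
    | [], _ => simp [liuLabel, RTree.P, B]
    | t :: ts, ih =>
      have h : RTree.Pprod (liuLabelList (S := S) (t :: ts)) = Bprod (t :: ts) := by
        rw [Pprod_eq, Bprod_eq, liuLabelList_eq, List.map_map]
        congr 1
        exact List.map_congr_left ih
      rw [liuLabel, B, ← h, liuLabelList, RTree.P]

theorem B_of_iso {S K : Type} {T T' : RTree K} (h : T.Iso T') :
    B (S := S) T = B T' := by
  induction h with
  | node k ts ts' e h ih =>
    have hl : ts.length = ts'.length := by simpa using Fintype.card_congr e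
    have hp : Bprod (S := S) ts = Bprod ts' := by
      rw [Bprod_eq, Bprod_eq, ← Fin.prod_univ_fun_getElem, ← Fin.prod_univ_fun_getElem,
        ← Equiv.prod_comp e]
      exact Finset.prod_congr rfl (fun i _ => ih i)
    match ts, ts', hl, hp with
    | [], [], _, _ => rfl
    | t :: ts, t' :: ts', _, hp => rw [B, B, hp]

open Polynomial

/-- Specialisation to `ℤ[y][x]`. -/
noncomputable def phi (S : Type) : MvPolynomial (Var S) ℤ →+* ℤ[X][X] :=
  MvPolynomial.eval₂Hom (Int.castRingHom _) (fun v => match v with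
    | .x _ => X
    | .y => C X
    | _ => 0)

noncomputable def beta (S : Type) {K : Type} (T : RTree K) : ℤ[X][X] := phi S (B T)

theorem beta_leaf (S : Type) {K : Type} (k : K) : beta S (.node k []) = X := by
  simp [beta, B, phi]

theorem beta_node (S : Type) {K : Type} (k : K) (ts : List (RTree K)) (h : ts ≠ []) :
    beta S (.node k ts) = C X + (ts.map (beta S)).prod := by
  match ts, h with
  | t :: ts, _ =>
    have h2 : ((t :: ts).map (beta S)) = ((t :: ts).map B).map (phi S) := by
      simp [beta]
    rw [h2, ← map_list_prod, ← Bprod_eq, beta, B, map_add]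
    simp [phi]

/-- The inductive package of facts. -/
def Good (p : ℤ[X][X]) : Prop :=
  p.Monic ∧ ∃ n, 1 ≤ n ∧ p.map (evalRingHom (0 : ℤ)) = X ^ n

theorem good_mul {p q : ℤ[X][X]} (hp : Good p) (hq : Good q) : Good (p * q) := by
  obtain ⟨hp, n, hn, hpn⟩ := hp
  obtain ⟨hq, m, hm, hqm⟩ := hq
  refine ⟨hp.mul hq, n + m, by omega, ?_⟩
  rw [Polynomial.map_mul, hpn, hqm, pow_add]

theorem good_natDegree {p : ℤ[X][X]} (hp : Good p) :
    1 ≤ p.natDegree ∧ p.map (evalRingHom (0 : ℤ)) = X ^ p.natDegree := by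
  obtain ⟨hp, n, hn, hpn⟩ := hp
  have := hp.natDegree_map (evalRingHom (0 : ℤ))
  rw [hpn, natDegree_X_pow] at this
  rw [← this]
  exact ⟨hn, hpn⟩

theorem good_add {p : ℤ[X][X]} (hp : Good p) : Good (C X + p) := by
  obtain ⟨h1, h2⟩ := good_natDegree hp
  refine ⟨hp.1.add_of_right ?_, p.natDegree, h1, by simp [h2]⟩
  refine lt_of_le_of_lt degree_C_le ?_
  exact natDegree_pos_iff_degree_pos.1 h1

theorem good_prod (l : List ℤ[X][X]) (hl : l ≠ []) (h : ∀ p ∈ l, Good p) : Good l.prod := by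
  induction l with
  | nil => exact absurd rfl hl
  | cons a l ih =>
    rw [List.prod_cons]
    by_cases hl' : l = []
    · subst hl'
      simpa using h
    · exact good_mul (h a (by simp)) (ih hl' (fun p hp => h p (by simp [hp])))

theorem good_beta (S : Type) {K : Type} (T : RTree K) : Good (beta S T) := by
  induction T using RTree.ind with
  | h k ts ih =>
    by_cases hts : ts = []
    · subst hts
      rw [beta_leaf]
      exact ⟨monic_X, 1, le_rfl, by simp⟩
    · rw [beta_node S k ts hts]
      apply good_add
      apply good_prod _ (by simpa using hts)
      intro p hp
      obtain ⟨a, ha, rfl⟩ := List.mem_map.1 hp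
      exact ih a ha

theorem good_coeff {p : ℤ[X][X]} (hp : Good p) (i : ℕ) (hi : i < p.natDegree) :
    X ∣ p.coeff i := by
  obtain ⟨h1, h2⟩ := good_natDegree hp
  have := congrArg (fun q => q.coeff i) h2
  simp only [coeff_map, coeff_X_pow, if_neg hi.ne] at this
  rw [X_dvd_iff, coeff_zero_eq_eval_zero]
  exact this

theorem beta_coeff (S : Type) {K : Type} (T : RTree K) :
    0 ≤ ((beta S T).coeff 0).coeff 1 := by
  induction T using RTree.ind with
  | h k ts ih =>
    match ts, ih with
    | [], _ => simp [beta_leaf]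
    | [t], ih =>
      have := ih t (by simp)
      rw [beta_node S k _ (by simp)]
      simp
      omega
    | t₁ :: t₂ :: ts, ih =>
      rw [beta_node S k _ (by simp)]
      obtain ⟨a, ha⟩ := good_coeff (good_beta S t₁) 0 (good_natDegree (good_beta S t₁)).1
      obtain ⟨b, hb⟩ := good_coeff (good_beta S t₂) 0 (good_natDegree (good_beta S t₂)).1
      simp only [List.map_cons, List.prod_cons, coeff_add, mul_coeff_zero, ha, hb, coeff_C_zero,
        coeff_X_one]
      rw [mul_assoc X a, coeff_X_mul, mul_coeff_zero]
      simp

theorem beta_coeff_pos (S : Type) {K : Type} (k : K) (ts : List (RTree K)) (hts : ts ≠ []) :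
    0 < ((beta S (.node k ts)).coeff 0).coeff 1 := by
  match ts, hts with
  | [t], _ =>
    have := beta_coeff S t
    rw [beta_node S k _ (by simp)]
    simp
    omega
  | t₁ :: t₂ :: ts, _ =>
    rw [beta_node S k _ (by simp)]
    obtain ⟨a, ha⟩ := good_coeff (good_beta S t₁) 0 (good_natDegree (good_beta S t₁)).1
    obtain ⟨b, hb⟩ := good_coeff (good_beta S t₂) 0 (good_natDegree (good_beta S t₂)).1
    simp only [List.map_cons, List.prod_cons, coeff_add, mul_coeff_zero, ha, hb, coeff_C_zero,
      coeff_X_one]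
    rw [mul_assoc X a, coeff_X_mul, mul_coeff_zero]
    simp

theorem beta_irreducible (S : Type) {K : Type} (T : RTree K) : Irreducible (beta S T) := by
  obtain ⟨k, ts⟩ := T
  by_cases hts : ts = []
  · subst hts
    rw [beta_leaf]
    exact irreducible_X
  have hg := good_beta S (.node k ts)
  have hpos := beta_coeff_pos S k ts hts
  have hP : (Ideal.span {(X : ℤ[X])}).IsPrime :=
    (Ideal.span_singleton_prime X_ne_zero).2 prime_X
  refine irreducible_of_eisenstein_criterion hP ?_ ?_ ?_ ?_ hg.1.isPrimitive
  · rw [hg.1.leadingCoeff]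
    exact fun h => hP.ne_top ((Ideal.eq_top_iff_one _).2 h)
  · intro n hn
    rw [Ideal.mem_span_singleton]
    exact good_coeff hg n (coe_lt_degree.1 hn)
  · exact natDegree_pos_iff_degree_pos.1 (good_natDegree hg).1
  · rw [Ideal.span_singleton_pow, Ideal.mem_span_singleton, X_pow_dvd_iff]
    intro h
    have := h 1 (by norm_num)
    omega

theorem exists_equiv_of_map_eq {α γ : Type} (f : α → γ) (l l' : List α)
    (h : (l.map f : Multiset γ) = (l'.map f : Multiset γ)) :
    ∃ e : Fin l.length ≃ Fin l'.length, ∀ i, f (l.get i) = f (l'.get (e i)) := by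
  classical
  have hc : ∀ (m : List α) (c : γ),
      Fintype.card {i : Fin m.length // f (m.get i) = c} = Multiset.count c (m.map f : Multiset γ) := by
    intro m c
    have h1 : (m.map f : Multiset γ)
        = Multiset.map (fun i => f (m.get i)) (Finset.univ : Finset (Fin m.length)).val := by
      rw [Fin.univ_val_map]
      congr 1
      apply List.ext_get <;> simp
    rw [h1, Multiset.count_map, Fintype.card_subtype, Finset.card_def, Finset.filter_val]
    congr 1
    exact Multiset.filter_congr (fun i _ => eq_comm)
  have he : ∀ c, Nonempty ({i : Fin l.length // f (l.get i) = c} ≃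
      {i : Fin l'.length // f (l'.get i) = c}) := fun c =>
    Fintype.card_eq.1 (by rw [hc, hc, h])
  let E := ((Equiv.sigmaFiberEquiv (fun i => f (l.get i))).symm.trans
    (Equiv.sigmaCongrRight (fun c => Classical.choice (he c)))).trans
    (Equiv.sigmaFiberEquiv (fun i => f (l'.get i)))
  exact ⟨E, fun i => ((Classical.choice (he (f (l.get i)))) ⟨i, rfl⟩).2.symm⟩

theorem iso_of_beta (S : Type) (T : RTree Unit) :
    ∀ T' : RTree Unit, beta S T = beta S T' → T.Iso T' := by
  induction T using RTree.ind with
  | h k ts ih =>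
    rintro ⟨k', ts'⟩ h
    by_cases hts : ts = []
    · subst hts
      by_cases hts' : ts' = []
      · subst hts'
        exact RTree.Iso.node _ _ _ (Equiv.refl _) (fun i => i.elim0)
      · have := beta_coeff_pos S k' ts' hts'
        rw [← h, beta_leaf] at this
        simp at this
    by_cases hts' : ts' = []
    · subst hts'
      have := beta_coeff_pos S k ts hts
      rw [h, beta_leaf] at this
      simp at this
    rw [beta_node S k ts hts, beta_node S k' ts' hts', add_right_inj] at h
    have hirr : ∀ l : List (RTree Unit), ∀ x ∈ ((l.map (beta S) : List _) : Multiset ℤ[X][X]),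
        Irreducible x ∧ x.Monic := by
      intro l x hx
      obtain ⟨a, _, rfl⟩ := List.mem_map.1 (Multiset.mem_coe.1 hx)
      exact ⟨beta_irreducible S a, (good_beta S a).1⟩
    have hrel := UniqueFactorizationMonoid.factors_unique (fun x hx => (hirr ts x hx).1)
      (fun x hx => (hirr ts' x hx).1) (by
        rw [Multiset.prod_coe, Multiset.prod_coe, h]; exact Associated.refl _)
    have heq := Multiset.rel_eq.1 (hrel.mono (fun a ha b hb hab =>
      eq_of_monic_of_associated (hirr ts a ha).2 (hirr ts' b hb).2 hab))
    obtain ⟨e, he⟩ := exists_equiv_of_map_eq (beta S) ts ts' heq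
    exact RTree.Iso.node _ _ _ e (fun i => ih _ (List.get_mem _ _) _ (he i))

end Helpers

/-- Let `T` be a rooted tree and let `λ` label every internal
vertex by `y` and every leaf by `x`. Then `(T,λ)` is a special pair and
`P(T,λ) = B(T)`. Consequently, for rooted trees `T` and `T'`, `B(T) = B(T')`
if and only if `T` is isomorphic to `T'`. -/
theorem liu_B_complete_invariant {S : Type} (T T' : RTree Unit) :
    IsSpecial (S := S) (liuLabel T) ∧ (liuLabel (S := S) T).P = B T ∧
      (B (S := S) T = B T' ↔ T.Iso T') := by
  exact ⟨liu_special T false, liu_P T,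
    fun h => iso_of_beta S T T' (congrArg (phi S) h), fun h => B_of_iso h⟩
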